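/- arXiv:1411.3498 — 5 statements merged into one kernel-verified Lean document; each statement's English description precedes it below -/
import Mathlib

section
/- For every natural number n, the number of quadruples (a,b,c,d) of natural numbers with a + 2b + 2c + 3d = n equals (n^3 + 12n^2 + 29n + 18)/72 + ((n+1)/72)·π_2(n) + (1/72)·π_6(n), where π_2 is the 2-periodic function with values 19, 10 on n even, odd respectively, and π_6 is the 6-periodic function with values 35, −8, 27, 8, 19, 0 according as n ≡ 0, 1, …, 5 (mod 6). (Equivalently, the coefficient of q^n in 1/((1−q)(1−q^2)^2(1−q^3)) is given by this quasipolynomial; this is the formula for the quadruple Kronecker coefficient g(n^2, n^2, n^2, n^2) associated to the affine Dynkin diagram D̂_4.) -/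
/-- The 2-periodic function with values `19, 10` on even, odd numbers. -/
def pi2 (n : ℕ) : ℚ := if n % 2 = 0 then 19 else 10

/-- The 6-periodic function with values `35, -8, 27, 8, 19, 0` on residues
`0, 1, …, 5` mod 6. -/
def pi6 (n : ℕ) : ℚ :=
  match n % 6 with
  | 0 => 35
  | 1 => -8
  | 2 => 27
  | 3 => 8
  | 4 => 19
  | _ => 0

/-- The solutions of `f x + k * y = n + k` split into those with `y = 0` and those with
`y ≥ 1`. -/
def fiberAddMulEquiv {α : Type*} (f : α → ℕ) (k n : ℕ) :
    {p : α × ℕ // f p.1 + k * p.2 = n + k} ≃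
      {x // f x = n + k} ⊕ {p : α × ℕ // f p.1 + k * p.2 = n} where
  toFun
    | ⟨(x, 0), h⟩ => Sum.inl ⟨x, by simpa using h⟩
    | ⟨(x, y + 1), h⟩ => Sum.inr ⟨(x, y), by simp only [mul_add] at h ⊢; omega⟩
  invFun
    | Sum.inl ⟨x, h⟩ => ⟨(x, 0), by simpa using h⟩
    | Sum.inr ⟨(x, y), h⟩ => ⟨(x, y + 1), by simp only [mul_add] at h ⊢; omega⟩
  left_inv := by rintro ⟨⟨x, _ | y⟩, h⟩ <;> rfl
  right_inv := by rintro (⟨x, h⟩ | ⟨⟨x, y⟩, h⟩) <;> rfl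

/-- For `n < k`, every solution of `f x + k * y = n` has `y = 0`. -/
def fiberAddMulEquivOfLt {α : Type*} (f : α → ℕ) {k n : ℕ} (hn : n < k) :
    {p : α × ℕ // f p.1 + k * p.2 = n} ≃ {x // f x = n} where
  toFun p := ⟨p.1.1, by
    obtain ⟨⟨x, _ | y⟩, h⟩ := p
    · simpa using h
    · simp only [mul_add] at h
      omega⟩
  invFun x := ⟨(x.1, 0), by simpa using x.2⟩
  left_inv := by
    rintro ⟨⟨x, _ | y⟩, h⟩
    · rfl
    · simp only [mul_add] at h
      omega
  right_inv _ := rfl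

theorem finite_fiber_add_mul {α : Type*} (f : α → ℕ) (hf : ∀ n, Finite {x // f x = n})
    {k : ℕ} (hk : 0 < k) (n : ℕ) : Finite {p : α × ℕ // f p.1 + k * p.2 = n} := by
  induction n using Nat.strong_induction_on with
  | _ n ih =>
    have := hf n
    rcases lt_or_ge n k with h | h
    · exact Finite.of_equiv _ (fiberAddMulEquivOfLt f h).symm
    · obtain ⟨m, rfl⟩ := Nat.exists_eq_add_of_le' h
      have := ih m (by omega)
      exact Finite.of_equiv _ (fiberAddMulEquiv f k m).symm

theorem card_fiber_add_mul {α : Type*} (f : α → ℕ) (hf : ∀ n, Finite {x // f x = n})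
    {k : ℕ} (hk : 0 < k) (n : ℕ) :
    Nat.card {p : α × ℕ // f p.1 + k * p.2 = n + k} =
      Nat.card {x // f x = n + k} + Nat.card {p : α × ℕ // f p.1 + k * p.2 = n} := by
  have := hf (n + k)
  have := finite_fiber_add_mul f hf hk n
  rw [Nat.card_congr (fiberAddMulEquiv f k n), Nat.card_sum]

theorem card_fiber_add_mul_of_lt {α : Type*} (f : α → ℕ) {k n : ℕ} (hn : n < k) :
    Nat.card {p : α × ℕ // f p.1 + k * p.2 = n} = Nat.card {x // f x = n} :=
  Nat.card_congr (fiberAddMulEquivOfLt f hn)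

theorem finite_fiber_two (n : ℕ) : Finite {p : ℕ × ℕ // p.1 + 2 * p.2 = n} :=
  finite_fiber_add_mul (fun a : ℕ => a) (fun _ => inferInstance) two_pos n

theorem finite_fiber_three (n : ℕ) :
    Finite {p : (ℕ × ℕ) × ℕ // p.1.1 + 2 * p.1.2 + 2 * p.2 = n} :=
  finite_fiber_add_mul (fun p : ℕ × ℕ => p.1 + 2 * p.2) finite_fiber_two two_pos n

theorem card_fiber_two (n : ℕ) : Nat.card {p : ℕ × ℕ // p.1 + 2 * p.2 = n} = n / 2 + 1 := by
  induction n using Nat.strong_induction_on with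
  | _ n ih =>
    rcases lt_or_ge n 2 with h | h
    · rw [card_fiber_add_mul_of_lt (fun a : ℕ => a) h, Nat.card_unique]
      omega
    · obtain ⟨m, rfl⟩ := Nat.exists_eq_add_of_le' h
      rw [card_fiber_add_mul (fun a : ℕ => a) (fun _ => inferInstance) two_pos,
        Nat.card_unique, ih m (by omega)]
      omega

theorem card_fiber_three (n : ℕ) :
    (Nat.card {p : (ℕ × ℕ) × ℕ // p.1.1 + 2 * p.1.2 + 2 * p.2 = n} : ℚ) =
      ((n / 2 : ℕ) + 1) * ((n / 2 : ℕ) + 2) / 2 := by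
  induction n using Nat.strong_induction_on with
  | _ n ih =>
    rcases lt_or_ge n 2 with h | h
    · rw [card_fiber_add_mul_of_lt (fun p : ℕ × ℕ => p.1 + 2 * p.2) h, card_fiber_two,
        Nat.div_eq_of_lt h]
      norm_num
    · obtain ⟨m, rfl⟩ := Nat.exists_eq_add_of_le' h
      rw [card_fiber_add_mul (fun p : ℕ × ℕ => p.1 + 2 * p.2) finite_fiber_two two_pos,
        card_fiber_two, Nat.cast_add, ih m (by omega), Nat.add_div_right m two_pos]
      push_cast
      ring

theorem card_fiber_four (n : ℕ) :
    (Nat.card {p : ((ℕ × ℕ) × ℕ) × ℕ //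
        p.1.1.1 + 2 * p.1.1.2 + 2 * p.1.2 + 3 * p.2 = n} : ℚ) =
      ((n : ℚ) ^ 3 + 12 * (n : ℚ) ^ 2 + 29 * (n : ℚ) + 18) / 72
        + (((n : ℚ) + 1) / 72) * pi2 n + (1 / 72) * pi6 n := by
  induction n using Nat.strong_induction_on with
  | _ n ih =>
    rcases lt_or_ge n 3 with h | h
    · rw [card_fiber_add_mul_of_lt (fun p : (ℕ × ℕ) × ℕ => p.1.1 + 2 * p.1.2 + 2 * p.2) h,
        card_fiber_three]
      interval_cases n <;> norm_num [pi2, pi6]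
    · obtain ⟨m, rfl⟩ := Nat.exists_eq_add_of_le' h
      rw [card_fiber_add_mul (fun p : (ℕ × ℕ) × ℕ => p.1.1 + 2 * p.1.2 + 2 * p.2)
        finite_fiber_three three_pos, Nat.cast_add, card_fiber_three, ih m (by omega)]
      obtain ⟨q, r, hr, rfl⟩ : ∃ q r, r < 6 ∧ m = 6 * q + r :=
        ⟨m / 6, m % 6, Nat.mod_lt _ (by norm_num), (Nat.div_add_mod m 6).symm⟩
      have half : (6 * q + r + 3) / 2 = 3 * q + (r + 3) / 2 := by omega
      have mod_two : (6 * q + r) % 2 = r % 2 := by omega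
      have mod_two' : (6 * q + r + 3) % 2 = (r + 3) % 2 := by omega
      have mod_six : (6 * q + r) % 6 = r % 6 := by omega
      have mod_six' : (6 * q + r + 3) % 6 = (r + 3) % 6 := by omega
      simp only [pi2, pi6, half, mod_two, mod_two', mod_six, mod_six']
      interval_cases r <;> norm_num <;> ring

/-- the number of quadruples `(a,b,c,d)` of natural numbers with
`a + 2b + 2c + 3d = n` equals
`(n³ + 12n² + 29n + 18)/72 + ((n+1)/72)·π₂(n) + (1/72)·π₆(n)`;
this is the quasipolynomial formula for the quadruple Kronecker coefficients
`g(n², n², n², n²)` associated to the affine Dynkin diagram `D̂₄`. -/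
theorem stmt9 (n : ℕ) :
    (Nat.card {p : ℕ × ℕ × ℕ × ℕ //
        p.1 + 2 * p.2.1 + 2 * p.2.2.1 + 3 * p.2.2.2 = n} : ℚ) =
      ((n : ℚ) ^ 3 + 12 * (n : ℚ) ^ 2 + 29 * (n : ℚ) + 18) / 72
        + (((n : ℚ) + 1) / 72) * pi2 n + (1 / 72) * pi6 n := by
  rw [← card_fiber_four n]
  congr 1
  exact Nat.card_congr
    { toFun := fun p => ⟨(((p.1.1, p.1.2.1), p.1.2.2.1), p.1.2.2.2), p.2⟩
      invFun := fun p => ⟨(p.1.1.1.1, p.1.1.1.2, p.1.1.2, p.1.2), p.2⟩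
      left_inv := fun _ => rfl
      right_inv := fun _ => rfl }
end

section
/- Let R = ℂ[x_{ijk} : i ∈ {1,2}, j ∈ {1,2}, k ∈ {1,2}] and let G = SL_2(ℂ) × SL_2(ℂ) × SL_2(ℂ) act on R by ℂ-algebra automorphisms determined by the linear substitution (g_1,g_2,g_3)·x_{ijk} = Σ_{i',j',k'} (g_1)_{i'i}(g_2)_{j'j}(g_3)_{k'k} x_{i'j'k'}. For every natural number d, the ℂ-vector space of polynomials in R that are homogeneous of degree d and fixed by every element of G has dimension 1 if 4 divides d, and dimension 0 otherwise. (Equivalently, the rectangular Kronecker coefficient g(n^2, n^2, n^2) equals 1 if n is even and 0 if n is odd; the degree-4 fundamental invariant is Cayley's hyperdeterminant, corresponding to the Dynkin diagram D_4, and (2^2, 2^2, 2^2) is a weakly stable triple.) -/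
noncomputable section

/-- The action of `(g₁, g₂, g₃) ∈ SL_{n₁}(ℂ) × SL_{n₂}(ℂ) × SL_{n₃}(ℂ)` on the
polynomial ring `ℂ[x_v : v ∈ Fin n₁ × Fin n₂ × Fin n₃]` by the linear substitution
`x_{ijk} ↦ ∑_{i',j',k'} (g₁)_{i'i} (g₂)_{j'j} (g₃)_{k'k} x_{i'j'k'}`. -/
def act (n₁ n₂ n₃ : ℕ)
    (g : Matrix.SpecialLinearGroup (Fin n₁) ℂ × Matrix.SpecialLinearGroup (Fin n₂) ℂ ×
      Matrix.SpecialLinearGroup (Fin n₃) ℂ) :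
    MvPolynomial (Fin n₁ × Fin n₂ × Fin n₃) ℂ →ₐ[ℂ] MvPolynomial (Fin n₁ × Fin n₂ × Fin n₃) ℂ :=
  MvPolynomial.aeval fun v : Fin n₁ × Fin n₂ × Fin n₃ =>
    ∑ w : Fin n₁ × Fin n₂ × Fin n₃,
      (g.1.val w.1 v.1 * g.2.1.val w.2.1 v.2.1 * g.2.2.val w.2.2 v.2.2) •
        (MvPolynomial.X w : MvPolynomial (Fin n₁ × Fin n₂ × Fin n₃) ℂ)

/-- The space of polynomials homogeneous of degree `d` fixed by every element of
`SL_{n₁}(ℂ) × SL_{n₂}(ℂ) × SL_{n₃}(ℂ)`. -/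
def invSpace (n₁ n₂ n₃ d : ℕ) :
    Submodule ℂ (MvPolynomial (Fin n₁ × Fin n₂ × Fin n₃) ℂ) :=
  MvPolynomial.homogeneousSubmodule (Fin n₁ × Fin n₂ × Fin n₃) ℂ d ⊓
    ⨅ g : Matrix.SpecialLinearGroup (Fin n₁) ℂ × Matrix.SpecialLinearGroup (Fin n₂) ℂ ×
        Matrix.SpecialLinearGroup (Fin n₃) ℂ,
      LinearMap.eqLocus (act n₁ n₂ n₃ g).toLinearMap LinearMap.id

/-- The substitution of `A`, `B`, `C` on the coordinates of a `2 × 2 × 2` tensor. -/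
def tensorAct (A B C : Matrix (Fin 2) (Fin 2) ℂ) (x : Fin 2 × Fin 2 × Fin 2 → ℂ) :
    Fin 2 × Fin 2 × Fin 2 → ℂ :=
  fun v => ∑ w : Fin 2 × Fin 2 × Fin 2, A w.1 v.1 * B w.2.1 v.2.1 * C w.2.2 v.2.2 * x w

/-- The tensor `e₀ ⊗ e₀ ⊗ e₀ + e₁ ⊗ e₁ ⊗ e₁`. -/
def unitTensor : Fin 2 × Fin 2 × Fin 2 → ℂ :=
  fun v => if v.1 = v.2.1 ∧ v.2.1 = v.2.2 then 1 else 0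

/-- Cayley's hyperdeterminant of a `2 × 2 × 2` array. -/
def hyperdet {R : Type*} [CommRing R] (x : Fin 2 × Fin 2 × Fin 2 → R) : R :=
  (x (0, 0, 0) * x (1, 1, 1) + x (0, 1, 1) * x (1, 0, 0)
    - x (0, 0, 1) * x (1, 1, 0) - x (0, 1, 0) * x (1, 0, 1)) ^ 2
  - 4 * (x (0, 0, 0) * x (0, 1, 1) - x (0, 0, 1) * x (0, 1, 0))
    * (x (1, 0, 0) * x (1, 1, 1) - x (1, 0, 1) * x (1, 1, 0))

/-- The upper right entry of `adj(X₀) X₁`, for the slices `Xₖ = (x_{ijk})_{ij}`. -/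
def pencilEntry {R : Type*} [CommRing R] (x : Fin 2 × Fin 2 × Fin 2 → R) : R :=
  x (1, 1, 0) * x (0, 1, 1) - x (0, 1, 0) * x (1, 1, 1)

/-- The determinant of the slice `X₀ = (x_{ij0})_{ij}`. -/
def sliceDet {R : Type*} [CommRing R] (x : Fin 2 × Fin 2 × Fin 2 → R) : R :=
  x (0, 0, 0) * x (1, 1, 0) - x (0, 1, 0) * x (1, 0, 0)

theorem map_hyperdet {R S : Type*} [CommRing R] [CommRing S] (φ : R →+* S)
    (x : Fin 2 × Fin 2 × Fin 2 → R) : φ (hyperdet x) = hyperdet (fun v => φ (x v)) := by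
  simp [hyperdet, map_ofNat]

theorem map_pencilEntry {R S : Type*} [CommRing R] [CommRing S] (φ : R →+* S)
    (x : Fin 2 × Fin 2 × Fin 2 → R) : φ (pencilEntry x) = pencilEntry (fun v => φ (x v)) := by
  simp [pencilEntry]

theorem map_sliceDet {R S : Type*} [CommRing R] [CommRing S] (φ : R →+* S)
    (x : Fin 2 × Fin 2 × Fin 2 → R) : φ (sliceDet x) = sliceDet (fun v => φ (x v)) := by
  simp [sliceDet]

theorem eval_act (g : Matrix.SpecialLinearGroup (Fin 2) ℂ × Matrix.SpecialLinearGroup (Fin 2) ℂ ×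
      Matrix.SpecialLinearGroup (Fin 2) ℂ) (x : Fin 2 × Fin 2 × Fin 2 → ℂ)
    (f : MvPolynomial (Fin 2 × Fin 2 × Fin 2) ℂ) :
    MvPolynomial.eval x (act 2 2 2 g f)
      = MvPolynomial.eval (tensorAct g.1.val g.2.1.val g.2.2.val x) f := by
  induction f using MvPolynomial.induction_on with
  | C a => simp [act]
  | add p q hp hq => simp [hp, hq]
  | mul_X p v hp =>
    rw [map_mul, map_mul, hp, map_mul, MvPolynomial.eval_X]
    simp [act, tensorAct, MvPolynomial.smul_eval]

theorem mem_invSpace_iff {d : ℕ} {f : MvPolynomial (Fin 2 × Fin 2 × Fin 2) ℂ} :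
    f ∈ invSpace 2 2 2 d ↔ f.IsHomogeneous d ∧
      ∀ A B C : Matrix.SpecialLinearGroup (Fin 2) ℂ, act 2 2 2 (A, B, C) f = f := by
  simp [invSpace, LinearMap.mem_eqLocus]

theorem eval_smul_of_isHomogeneous {σ : Type*} {d : ℕ} {f : MvPolynomial σ ℂ}
    (hf : f.IsHomogeneous d) (t : ℂ) (x : σ → ℂ) :
    MvPolynomial.eval (t • x) f = t ^ d * MvPolynomial.eval x f := by
  rw [MvPolynomial.eval_eq, MvPolynomial.eval_eq, Finset.mul_sum]
  refine Finset.sum_congr rfl fun m hm => ?_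
  have hd := hf (MvPolynomial.mem_support_iff.mp hm)
  rw [Finsupp.weight_apply] at hd
  simp only [Finsupp.sum, Pi.one_apply, smul_eq_mul, mul_one] at hd
  simp only [Pi.smul_apply, smul_eq_mul, mul_pow, Finset.prod_mul_distrib,
    Finset.prod_pow_eq_pow_sum, hd]
  ring

theorem exists_eq_smul_specialLinearGroup (A : Matrix (Fin 2) (Fin 2) ℂ) (hA : A.det ≠ 0) :
    ∃ (t : ℂ) (g : Matrix.SpecialLinearGroup (Fin 2) ℂ), A = t • g.val := by
  obtain ⟨t, ht⟩ := IsAlgClosed.exists_pow_nat_eq A.det (n := 2) (by norm_num)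
  have ht0 : t ≠ 0 := by
    rintro rfl
    exact hA (by simpa using ht.symm)
  refine ⟨t, ⟨t⁻¹ • A, ?_⟩, ?_⟩
  · rw [Matrix.det_smul, Fintype.card_fin, ← ht]
    field_simp
  · simp [smul_smul, ht0]

theorem tensorAct_smul (a b c : ℂ) (A B C : Matrix (Fin 2) (Fin 2) ℂ)
    (x : Fin 2 × Fin 2 × Fin 2 → ℂ) :
    tensorAct (a • A) (b • B) (c • C) x = (a * b * c) • tensorAct A B C x := by
  funext v
  simp only [tensorAct, Pi.smul_apply, Matrix.smul_apply, smul_eq_mul, Finset.mul_sum]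
  exact Finset.sum_congr rfl fun w _ => by ring

theorem eval_tensorAct_of_mem_invSpace {d : ℕ} {f : MvPolynomial (Fin 2 × Fin 2 × Fin 2) ℂ}
    (hf : f ∈ invSpace 2 2 2 d) (A B C : Matrix.SpecialLinearGroup (Fin 2) ℂ)
    (x : Fin 2 × Fin 2 × Fin 2 → ℂ) :
    MvPolynomial.eval (tensorAct A.val B.val C.val x) f = MvPolynomial.eval x f := by
  rw [← eval_act (A, B, C), (mem_invSpace_iff.mp hf).2]

theorem tensorAct_unitTensor (A B C : Matrix (Fin 2) (Fin 2) ℂ) (v : Fin 2 × Fin 2 × Fin 2) :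
    tensorAct A B C unitTensor v
      = A 0 v.1 * B 0 v.2.1 * C 0 v.2.2 + A 1 v.1 * B 1 v.2.1 * C 1 v.2.2 := by
  simp [tensorAct, unitTensor, Fintype.sum_prod_type]

/-- A generic tensor is equivalent to the unit tensor under the general linear groups. -/
theorem exists_tensorAct_unitTensor_eq (x : Fin 2 × Fin 2 × Fin 2 → ℂ)
    (h1 : sliceDet x ≠ 0) (h2 : pencilEntry x ≠ 0) (h3 : hyperdet x ≠ 0) :
    ∃ A B C : Matrix (Fin 2) (Fin 2) ℂ, A.det ≠ 0 ∧ B.det ≠ 0 ∧ C.det ≠ 0 ∧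
      x = tensorAct A B C unitTensor := by
  obtain ⟨s, hs⟩ := IsAlgClosed.exists_pow_nat_eq (hyperdet x) (n := 2) (by norm_num)
  have hs0 : s ≠ 0 := by
    rintro rfl
    exact h3 (by simpa using hs.symm)
  -- `N = adj(X₀) X₁`, with eigenvalues `l`, `m` and eigenvectors `(n, l - a)`, `(n, m - a)`
  set n := pencilEntry x with hn
  set δ := sliceDet x with hδ
  obtain ⟨a, ha⟩ : ∃ a, a = x (1, 1, 0) * x (0, 0, 1) - x (0, 1, 0) * x (1, 0, 1) := ⟨_, rfl⟩
  obtain ⟨e, he⟩ : ∃ e, e = x (0, 0, 0) * x (1, 1, 1) - x (1, 0, 0) * x (0, 1, 1) := ⟨_, rfl⟩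
  obtain ⟨l, hl⟩ : ∃ l, l = (a + e + s) / 2 := ⟨_, rfl⟩
  obtain ⟨m, hm⟩ : ∃ m, m = (a + e - s) / 2 := ⟨_, rfl⟩
  obtain ⟨p, hp⟩ : ∃ p, p = x (0, 0, 0) * x (1, 0, 1) - x (1, 0, 0) * x (0, 0, 1) := ⟨_, rfl⟩
  have hsub : l - m = s := by rw [hl, hm]; ring
  have hadd : l + m = a + e := by rw [hl, hm]; ring
  have hmul : l * m = a * e - n * p := by
    rw [hl, hm, ha, he, hn, hp, pencilEntry]
    rw [hyperdet] at hs
    linear_combination (-1 / 4) * hs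
  have h00 : ∀ i, x (i, 0, 0) * a + x (i, 1, 0) * p = δ * x (i, 0, 1) := by
    intro i
    rw [ha, hp, hδ, sliceDet]
    fin_cases i <;> simp <;> ring
  have h01 : ∀ i, x (i, 0, 0) * n + x (i, 1, 0) * e = δ * x (i, 1, 1) := by
    intro i
    rw [hn, he, hδ, sliceDet, pencilEntry]
    fin_cases i <;> simp <;> ring
  clear_value n δ
  refine ⟨.of fun r i => x (i, 0, 0) * n + x (i, 1, 0) * (![l, m] r - a),
    (n * s)⁻¹ • !![a - m, n; l - a, -n], !![1, l / δ; 1, m / δ], ?_, ?_, ?_, ?_⟩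
  · have : δ * n * s ≠ 0 := by positivity
    rw [Matrix.det_fin_two]
    simp only [Matrix.of_apply, Matrix.cons_val_zero, Matrix.cons_val_one]
    rw [sliceDet] at hδ
    intro h
    apply this
    rw [hδ, ← hsub]
    linear_combination -h
  · rw [Matrix.det_smul, Matrix.det_fin_two_of]
    refine mul_ne_zero (by simp [h2, hs0]) ?_
    rw [show (a - m) * -n - n * (l - a) = -(n * s) by rw [← hsub]; ring]
    simp [h2, hs0]
  · rw [Matrix.det_fin_two_of, show 1 * (m / δ) - l / δ * 1 = -s / δ by rw [← hsub]; ring]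
    simp [h1, hs0]
  · funext ⟨i, j, k⟩
    rw [tensorAct_unitTensor]
    fin_cases j <;> fin_cases k <;> simp <;> field_simp
    · linear_combination -x (i, 0, 0) * n * hsub
    · linear_combination -n * s * h00 i - (x (i, 0, 0) * a + x (i, 1, 0) * p) * n * hsub
        - x (i, 1, 0) * (l - m) * (a * hadd - hmul)
    · linear_combination -x (i, 1, 0) * hsub
    · linear_combination -s * h01 i - (x (i, 0, 0) * n + x (i, 1, 0) * e) * hsub
        - x (i, 1, 0) * (l - m) * hadd

theorem eval_eq_zero_of_eval_unitTensor {d : ℕ} {f : MvPolynomial (Fin 2 × Fin 2 × Fin 2) ℂ}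
    (hf : f ∈ invSpace 2 2 2 d) (h0 : MvPolynomial.eval unitTensor f = 0) : f = 0 := by
  let X : Fin 2 × Fin 2 × Fin 2 → MvPolynomial (Fin 2 × Fin 2 × Fin 2) ℂ := MvPolynomial.X
  have hX (x : Fin 2 × Fin 2 × Fin 2 → ℂ) : (fun v => MvPolynomial.eval x (X v)) = x := by
    funext v
    simp [X]
  have hne (P : MvPolynomial (Fin 2 × Fin 2 × Fin 2) ℂ) (x : Fin 2 × Fin 2 × Fin 2 → ℂ)
      (h : MvPolynomial.eval x P ≠ 0) : P ≠ 0 := by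
    rintro rfl
    simp at h
  have h1 : sliceDet X ≠ 0 := by
    refine hne _ (fun v => if v.1 = v.2.1 then 1 else 0) ?_
    rw [map_sliceDet, hX]
    simp [sliceDet]
  have h2 : pencilEntry X ≠ 0 := by
    refine hne _ (fun v => if v = (1, 1, 0) ∨ v = (0, 1, 1) then 1 else 0) ?_
    rw [map_pencilEntry, hX]
    simp [pencilEntry]
  have h3 : hyperdet X ≠ 0 := by
    refine hne _ unitTensor ?_
    rw [map_hyperdet, hX]
    simp [hyperdet, unitTensor]
  suffices h : f * (sliceDet X * pencilEntry X * hyperdet X) = 0 by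
    simpa [h1, h2, h3] using h
  refine MvPolynomial.funext fun x => ?_
  rw [map_mul, map_mul, map_mul, map_sliceDet, map_pencilEntry, map_hyperdet, hX, map_zero]
  by_contra h
  simp only [mul_eq_zero, not_or] at h
  obtain ⟨hx, ⟨hx1, hx2⟩, hx3⟩ := h
  obtain ⟨A, B, C, hA, hB, hC, hxeq⟩ := exists_tensorAct_unitTensor_eq x hx1 hx2 hx3
  obtain ⟨a, A, rfl⟩ := exists_eq_smul_specialLinearGroup A hA
  obtain ⟨b, B, rfl⟩ := exists_eq_smul_specialLinearGroup B hB
  obtain ⟨c, C, rfl⟩ := exists_eq_smul_specialLinearGroup C hC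
  apply hx
  rw [hxeq, tensorAct_smul, eval_smul_of_isHomogeneous (mem_invSpace_iff.mp hf).1,
    eval_tensorAct_of_mem_invSpace hf, h0, mul_zero]

theorem eval_unitTensor_eq_I_pow_mul {d : ℕ} {f : MvPolynomial (Fin 2 × Fin 2 × Fin 2) ℂ}
    (hf : f ∈ invSpace 2 2 2 d) :
    MvPolynomial.eval unitTensor f = Complex.I ^ d * MvPolynomial.eval unitTensor f := by
  let w : Matrix.SpecialLinearGroup (Fin 2) ℂ := ⟨!![0, 1; -1, 0], by simp⟩
  let u : Matrix.SpecialLinearGroup (Fin 2) ℂ :=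
    ⟨!![0, Complex.I; Complex.I, 0], by simp [Matrix.det_fin_two_of]⟩
  have h : tensorAct u.val w.val w.val unitTensor = Complex.I • unitTensor := by
    funext ⟨i, j, k⟩
    rw [tensorAct_unitTensor]
    fin_cases i <;> fin_cases j <;> fin_cases k <;> simp [u, w, unitTensor]
  rw [← eval_smul_of_isHomogeneous (mem_invSpace_iff.mp hf).1, ← h,
    eval_tensorAct_of_mem_invSpace hf]

theorem tensorAct_eq_comp (A B C : Matrix (Fin 2) (Fin 2) ℂ) (x : Fin 2 × Fin 2 × Fin 2 → ℂ) :
    tensorAct A B C x = tensorAct A 1 1 (tensorAct 1 B 1 (tensorAct 1 1 C x)) := by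
  funext v
  simp [tensorAct, Fintype.sum_prod_type, Matrix.one_apply]
  ring

theorem hyperdet_tensorAct (A B C : Matrix (Fin 2) (Fin 2) ℂ) (x : Fin 2 × Fin 2 × Fin 2 → ℂ) :
    hyperdet (tensorAct A B C x) = (A.det * B.det * C.det) ^ 2 * hyperdet x := by
  have hA (x) : hyperdet (tensorAct A 1 1 x) = A.det ^ 2 * hyperdet x := by
    simp [hyperdet, tensorAct, Fintype.sum_prod_type, Matrix.one_apply, Matrix.det_fin_two]
    ring
  have hB (x) : hyperdet (tensorAct 1 B 1 x) = B.det ^ 2 * hyperdet x := by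
    simp [hyperdet, tensorAct, Fintype.sum_prod_type, Matrix.one_apply, Matrix.det_fin_two]
    ring
  have hC (x) : hyperdet (tensorAct 1 1 C x) = C.det ^ 2 * hyperdet x := by
    simp [hyperdet, tensorAct, Fintype.sum_prod_type, Matrix.one_apply, Matrix.det_fin_two]
    ring
  rw [tensorAct_eq_comp, hA, hB, hC]
  ring

theorem eval_hyperdet_X (x : Fin 2 × Fin 2 × Fin 2 → ℂ) :
    MvPolynomial.eval x (hyperdet MvPolynomial.X) = hyperdet x := by
  rw [map_hyperdet]
  simp

theorem isHomogeneous_hyperdet_X :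
    (hyperdet (MvPolynomial.X : _ → MvPolynomial (Fin 2 × Fin 2 × Fin 2) ℂ)).IsHomogeneous 4 := by
  have hX (v w : Fin 2 × Fin 2 × Fin 2) :
      (MvPolynomial.X v * MvPolynomial.X w : MvPolynomial _ ℂ).IsHomogeneous 2 :=
    (MvPolynomial.isHomogeneous_X ℂ v).mul (MvPolynomial.isHomogeneous_X ℂ w)
  have h4 : (4 : MvPolynomial (Fin 2 × Fin 2 × Fin 2) ℂ).IsHomogeneous 0 :=
    MvPolynomial.isHomogeneous_C _ (4 : ℂ)
  exact (((((hX _ _).add (hX _ _)).sub (hX _ _)).sub (hX _ _)).pow 2).sub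
    ((h4.mul ((hX _ _).sub (hX _ _))).mul ((hX _ _).sub (hX _ _)))

theorem hyperdet_pow_mem_invSpace (k : ℕ) :
    (hyperdet MvPolynomial.X ^ k : MvPolynomial (Fin 2 × Fin 2 × Fin 2) ℂ)
      ∈ invSpace 2 2 2 (4 * k) := by
  refine mem_invSpace_iff.mpr ⟨isHomogeneous_hyperdet_X.pow k, fun A B C => ?_⟩
  refine MvPolynomial.funext fun x => ?_
  rw [eval_act, map_pow, map_pow, eval_hyperdet_X, eval_hyperdet_X, hyperdet_tensorAct]
  simp

/-- for the action of `SL₂(ℂ) × SL₂(ℂ) × SL₂(ℂ)` on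
`ℂ[x_{ijk} : i,j,k ∈ {1,2}]`, the space of invariant polynomials homogeneous of
degree `d` has dimension `1` if `4 ∣ d` and `0` otherwise (Cayley's
hyperdeterminant, Dynkin diagram `D₄`; `(2², 2², 2²)` is weakly stable). -/
theorem stmt10 (d : ℕ) :
    Module.rank ℂ ↥(invSpace 2 2 2 d) = if 4 ∣ d then 1 else 0 := by
  split_ifs with hd
  · obtain ⟨k, rfl⟩ := hd
    have hone : MvPolynomial.eval unitTensor (hyperdet MvPolynomial.X ^ k) = 1 := by
      rw [map_pow, eval_hyperdet_X]
      simp [hyperdet, unitTensor]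
    refine Module.rank_eq_one_iff_finrank_eq_one.mpr
      (finrank_eq_one ⟨_, hyperdet_pow_mem_invSpace k⟩ ?_ fun f => ?_)
    · intro h
      rw [Submodule.mk_eq_zero] at h
      simp [h] at hone
    · refine ⟨MvPolynomial.eval unitTensor f.val, Subtype.ext ?_⟩
      refine sub_eq_zero.mp (eval_eq_zero_of_eval_unitTensor (Submodule.sub_mem _
        (Submodule.smul_mem _ _ (hyperdet_pow_mem_invSpace k)) f.2) ?_)
      simp only [Submodule.coe_smul, map_sub, MvPolynomial.smul_eval, hone, mul_one, sub_self]
  · rw [rank_zero_iff_forall_zero]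
    intro f
    refine Subtype.ext (eval_eq_zero_of_eval_unitTensor f.2 ?_)
    by_contra h
    have hI : Complex.I ^ d = 1 := by
      simpa [h] using (eval_unitTensor_eq_I_pow_mul f.2).symm
    exact hd (Complex.isPrimitiveRoot_I.dvd_of_pow_eq_one d hI)
end
end

section
/- Let R = ℂ[x_{ijk} : i ∈ {1,2}, j ∈ {1,2}, k ∈ {1,2,3,4}] and let G = SL_2(ℂ) × SL_2(ℂ) × SL_4(ℂ) act on R by ℂ-algebra automorphisms determined by the linear substitution (g_1,g_2,g_3)·x_{ijk} = Σ_{i',j',k'} (g_1)_{i'i}(g_2)_{j'j}(g_3)_{k'k} x_{i'j'k'}. For every natural number d, the ℂ-vector space of polynomials in R that are homogeneous of degree d and fixed by every element of G has dimension 1 if 4 divides d, and dimension 0 otherwise. (This corresponds to the Dynkin diagram D_6, whose fundamental invariant has degree 4, and shows that (2^2, 2^2, 1^4) is a weakly stable triple.) -/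
noncomputable section

open scoped Kronecker

/-- The linear substitution underlying `act`, on points of `ℂ^{n₁} ⊗ ℂ^{n₂} ⊗ ℂ^{n₃}`. -/
def actPoint (n₁ n₂ n₃ : ℕ)
    (g : Matrix.SpecialLinearGroup (Fin n₁) ℂ × Matrix.SpecialLinearGroup (Fin n₂) ℂ ×
      Matrix.SpecialLinearGroup (Fin n₃) ℂ) (p : Fin n₁ × Fin n₂ × Fin n₃ → ℂ) :
    Fin n₁ × Fin n₂ × Fin n₃ → ℂ := fun v =>
  ∑ w : Fin n₁ × Fin n₂ × Fin n₃,
    (g.1.val w.1 v.1 * g.2.1.val w.2.1 v.2.1 * g.2.2.val w.2.2 v.2.2) * p w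

theorem eval_act_s12 (n₁ n₂ n₃ : ℕ)
    (g : Matrix.SpecialLinearGroup (Fin n₁) ℂ × Matrix.SpecialLinearGroup (Fin n₂) ℂ ×
      Matrix.SpecialLinearGroup (Fin n₃) ℂ) (p : Fin n₁ × Fin n₂ × Fin n₃ → ℂ)
    (f : MvPolynomial (Fin n₁ × Fin n₂ × Fin n₃) ℂ) :
    MvPolynomial.eval p (act n₁ n₂ n₃ g f) = MvPolynomial.eval (actPoint n₁ n₂ n₃ g p) f := by
  induction f using MvPolynomial.induction_on with
  | C a => simp [act]
  | add f₁ f₂ h₁ h₂ => simp only [map_add, h₁, h₂]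
  | mul_X f v h =>
    rw [map_mul, map_mul, h, map_mul]
    simp [act, actPoint, MvPolynomial.smul_eval]

theorem mem_invSpace_iff_s12 (n₁ n₂ n₃ d : ℕ) (f : MvPolynomial (Fin n₁ × Fin n₂ × Fin n₃) ℂ) :
    f ∈ invSpace n₁ n₂ n₃ d ↔ f.IsHomogeneous d ∧
      ∀ g p, MvPolynomial.eval (actPoint n₁ n₂ n₃ g p) f = MvPolynomial.eval p f := by
  rw [invSpace, Submodule.mem_inf, MvPolynomial.mem_homogeneousSubmodule, Submodule.mem_iInf]
  refine and_congr_right fun _ => forall_congr' fun g => ?_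
  simp only [LinearMap.mem_eqLocus, AlgHom.toLinearMap_apply, LinearMap.id_apply, ← eval_act_s12]
  exact ⟨fun h p => by rw [h], fun h => MvPolynomial.funext h⟩

theorem MvPolynomial.IsHomogeneous.eval_const_mul {σ R : Type*} [CommSemiring R]
    {f : MvPolynomial σ R} {d : ℕ} (hf : f.IsHomogeneous d) (c : R) (p : σ → R) :
    MvPolynomial.eval (fun v => c * p v) f = c ^ d * MvPolynomial.eval p f := by
  rw [MvPolynomial.eval_eq, MvPolynomial.eval_eq, Finset.mul_sum]
  refine Finset.sum_congr rfl fun m hm => ?_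
  simp only [mul_pow, Finset.prod_mul_distrib, Finset.prod_pow_eq_pow_sum]
  rw [← hf.degree_eq_sum_deg_support hm, mul_left_comm]

/-- A `2 × 2 × 4` array read as a `4 × 4` matrix, with rows indexed by the first two indices. -/
def flatten {R : Type*} (p : Fin 2 × Fin 2 × Fin 4 → R) :
    Matrix (Fin 2 × Fin 2) (Fin 2 × Fin 2) R :=
  Matrix.of fun a b => p (a.1, a.2, finProdFinEquiv b)

theorem flatten_actPoint
    (g : Matrix.SpecialLinearGroup (Fin 2) ℂ × Matrix.SpecialLinearGroup (Fin 2) ℂ ×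
      Matrix.SpecialLinearGroup (Fin 4) ℂ) (p : Fin 2 × Fin 2 × Fin 4 → ℂ) :
    flatten (actPoint 2 2 4 g p) =
      (g.1.val ⊗ₖ g.2.1.val).transpose * flatten p *
        g.2.2.val.submatrix (finProdFinEquiv (m := 2) (n := 2)) finProdFinEquiv := by
  ext a b
  simp only [flatten, actPoint, Matrix.of_apply, Matrix.mul_apply, Matrix.transpose_apply,
    Matrix.kroneckerMap_apply, Matrix.submatrix_apply, Finset.sum_mul]
  rw [Finset.sum_comm, Fintype.sum_prod_type, Fintype.sum_prod_type]
  refine Finset.sum_congr rfl fun i _ => ?_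
  rw [Fintype.sum_prod_type]
  refine Finset.sum_congr rfl fun j _ => ?_
  rw [← Equiv.sum_comp (finProdFinEquiv (m := 2) (n := 2))]
  exact Finset.sum_congr rfl fun k _ => by ring

theorem det_flatten_actPoint
    (g : Matrix.SpecialLinearGroup (Fin 2) ℂ × Matrix.SpecialLinearGroup (Fin 2) ℂ ×
      Matrix.SpecialLinearGroup (Fin 4) ℂ) (p : Fin 2 × Fin 2 × Fin 4 → ℂ) :
    (flatten (actPoint 2 2 4 g p)).det = (flatten p).det := by
  have h := Matrix.det_submatrix_equiv_self (finProdFinEquiv (m := 2) (n := 2)) g.2.2.val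
  rw [flatten_actPoint, Matrix.det_mul, Matrix.det_mul, Matrix.det_transpose,
    Matrix.det_kronecker, h]
  simp

/-- The fundamental invariant: the determinant of the flattened array of variables. -/
def flatDet : MvPolynomial (Fin 2 × Fin 2 × Fin 4) ℂ := (flatten MvPolynomial.X).det

theorem eval_flatDet (p : Fin 2 × Fin 2 × Fin 4 → ℂ) :
    MvPolynomial.eval p flatDet = (flatten p).det := by
  rw [flatDet, RingHom.map_det]
  congr 1
  ext a b
  simp [flatten]

theorem flatDet_isHomogeneous : flatDet.IsHomogeneous 4 := by
  rw [flatDet, Matrix.det_apply]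
  refine MvPolynomial.IsHomogeneous.sum _ _ _ fun s _ => ?_
  have h : (∏ i, flatten (MvPolynomial.X (R := ℂ)) (s i) i).IsHomogeneous 4 := by
    convert MvPolynomial.IsHomogeneous.prod Finset.univ
      (fun i => flatten (MvPolynomial.X (R := ℂ)) (s i) i) (fun _ => 1)
      fun i _ => MvPolynomial.isHomogeneous_X _ _
    simp
  rcases Int.units_eq_one_or (Equiv.Perm.sign s) with hs | hs
  · simpa [hs] using h
  · simpa [hs] using h.neg

/-- The array whose flattening is the identity matrix. -/
def unitArray : Fin 2 × Fin 2 × Fin 4 → ℂ := fun v =>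
  (1 : Matrix (Fin 2 × Fin 2) (Fin 2 × Fin 2) ℂ) (v.1, v.2.1) (finProdFinEquiv.symm v.2.2)

theorem flatten_unitArray : flatten unitArray = 1 := by
  ext a b
  exact congrArg ((1 : Matrix (Fin 2 × Fin 2) (Fin 2 × Fin 2) ℂ) a)
    (finProdFinEquiv.symm_apply_apply b)

theorem flatten_injective {R : Type*} :
    Function.Injective (flatten : (Fin 2 × Fin 2 × Fin 4 → R) → _) := by
  intro p q h
  ext ⟨i, j, k⟩
  have := congrFun (congrFun h (i, j)) ((finProdFinEquiv (m := 2) (n := 2)).symm k)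
  simpa only [flatten, Matrix.of_apply, Equiv.apply_symm_apply] using this

theorem flatDet_ne_zero : flatDet ≠ 0 := fun h => by
  have := eval_flatDet unitArray
  simp [h, flatten_unitArray] at this

/-- Every array with `det = c ^ 4 ≠ 0` lies in the orbit of `c` times the unit array. -/
theorem exists_actPoint_eq (p : Fin 2 × Fin 2 × Fin 4 → ℂ) {c : ℂ} (hc : c ≠ 0)
    (h : (flatten p).det = c ^ 4) :
    ∃ g, actPoint 2 2 4 g (fun v => c * unitArray v) = p := by
  let A : Matrix (Fin 4) (Fin 4) ℂ :=
    c⁻¹ • (flatten p).submatrix finProdFinEquiv.symm finProdFinEquiv.symm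
  have hA : A.det = 1 := by
    have := Matrix.det_submatrix_equiv_self (finProdFinEquiv (m := 2) (n := 2)).symm (flatten p)
    rw [Matrix.det_smul, this, h, Fintype.card_fin, ← mul_pow, inv_mul_cancel₀ hc, one_pow]
  refine ⟨(1, 1, ⟨A, hA⟩), flatten_injective ?_⟩
  have hu : flatten (fun v => c * unitArray v) = c • (1 : Matrix _ _ ℂ) := by
    rw [← flatten_unitArray]; rfl
  rw [flatten_actPoint, hu]
  ext a b
  simp [A, hc]

theorem eval_of_mem_invSpace {d : ℕ} {f : MvPolynomial (Fin 2 × Fin 2 × Fin 4) ℂ}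
    (hf : f ∈ invSpace 2 2 4 d) (p : Fin 2 × Fin 2 × Fin 4 → ℂ) {c : ℂ} (hc : c ≠ 0)
    (h : (flatten p).det = c ^ 4) :
    MvPolynomial.eval p f = c ^ d * MvPolynomial.eval unitArray f := by
  obtain ⟨hd, hinv⟩ := (mem_invSpace_iff_s12 2 2 4 d f).1 hf
  obtain ⟨g, rfl⟩ := exists_actPoint_eq p hc h
  rw [hinv, hd.eval_const_mul]

theorem eq_of_eval_eq_of_det_ne_zero {f₁ f₂ : MvPolynomial (Fin 2 × Fin 2 × Fin 4) ℂ}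
    (h : ∀ p, (flatten p).det ≠ 0 → MvPolynomial.eval p f₁ = MvPolynomial.eval p f₂) :
    f₁ = f₂ := by
  refine mul_right_cancel₀ flatDet_ne_zero (MvPolynomial.funext fun p => ?_)
  rw [map_mul, map_mul, eval_flatDet]
  by_cases hp : (flatten p).det = 0
  · simp [hp]
  · rw [h p hp]

theorem invSpace_eq_bot {d : ℕ} (hd : ¬ 4 ∣ d) : invSpace 2 2 4 d = ⊥ := by
  refine (Submodule.eq_bot_iff _).2 fun f hf => ?_
  have h₀ : MvPolynomial.eval unitArray f = 0 := by
    have h := eval_of_mem_invSpace hf unitArray Complex.I_ne_zero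
      (by rw [flatten_unitArray, Matrix.det_one, Complex.I_pow_four])
    by_contra hne
    refine hd ?_
    have h₁ : Complex.I ^ d = 1 := mul_right_cancel₀ hne (by rw [← h, one_mul])
    have h₂ := Complex.isPrimitiveRoot_exp 4 four_ne_zero
    rw [show 2 * Real.pi * Complex.I / (4 : ℕ) = Real.pi / 2 * Complex.I by push_cast; ring,
      Complex.exp_pi_div_two_mul_I] at h₂
    exact h₂.dvd_of_pow_eq_one d h₁
  refine eq_of_eval_eq_of_det_ne_zero fun p hp => ?_
  obtain ⟨c, hc⟩ := IsAlgClosed.exists_pow_nat_eq (flatten p).det (n := 4) (by norm_num)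
  have hc₀ : c ≠ 0 := by rintro rfl; exact hp (by rw [← hc]; norm_num)
  rw [eval_of_mem_invSpace hf p hc₀ hc.symm, h₀, mul_zero, map_zero]

theorem invSpace_eq_span (k : ℕ) : invSpace 2 2 4 (4 * k) = Submodule.span ℂ {flatDet ^ k} := by
  refine le_antisymm (fun f hf => ?_) ?_
  · refine Submodule.mem_span_singleton.2 ⟨MvPolynomial.eval unitArray f, ?_⟩
    refine eq_of_eval_eq_of_det_ne_zero fun p hp => ?_
    obtain ⟨c, hc⟩ := IsAlgClosed.exists_pow_nat_eq (flatten p).det (n := 4) (by norm_num)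
    have hc₀ : c ≠ 0 := by rintro rfl; exact hp (by rw [← hc]; norm_num)
    rw [eval_of_mem_invSpace hf p hc₀ hc.symm, MvPolynomial.smul_eval, map_pow, eval_flatDet,
      ← hc, pow_mul, mul_comm]
  · rw [Submodule.span_singleton_le_iff_mem, mem_invSpace_iff_s12]
    refine ⟨flatDet_isHomogeneous.pow k, fun g p => ?_⟩
    rw [map_pow, map_pow, eval_flatDet, eval_flatDet, det_flatten_actPoint]

/-- for the action of `SL₂(ℂ) × SL₂(ℂ) × SL₄(ℂ)` on `ℂ[x_{ijk}]`, the space of invariant polynomials homogeneous of degree `d` has dimension `1` if `4 ∣ d` and `0` otherwise (Dynkin diagram `D₆`; `(2², 2², 1⁴)` is weakly stable). -/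
theorem stmt12 (d : ℕ) :
    Module.rank ℂ ↥(invSpace 2 2 4 d) = if 4 ∣ d then 1 else 0 := by
  split_ifs with hd
  · obtain ⟨k, rfl⟩ := hd
    rw [invSpace_eq_span, ← Module.finrank_eq_rank,
      finrank_span_singleton (pow_ne_zero k flatDet_ne_zero), Nat.cast_one]
  · rw [invSpace_eq_bot hd, rank_bot]
end
end

section
/- Let R = ℂ[x_{ijk} : i ∈ {1,2}, j ∈ {1,2,3}, k ∈ {1,2,3,4}] and let G = SL_2(ℂ) × SL_3(ℂ) × SL_4(ℂ) act on R by ℂ-algebra automorphisms determined by the linear substitution (g_1,g_2,g_3)·x_{ijk} = Σ_{i',j',k'} (g_1)_{i'i}(g_2)_{j'j}(g_3)_{k'k} x_{i'j'k'}. For every natural number d, the ℂ-vector space of polynomials in R that are homogeneous of degree d and fixed by every element of G has dimension 1 if 12 divides d, and dimension 0 otherwise. (This corresponds to the Dynkin diagram E_7, whose fundamental invariant has degree 12, and shows that (6^2, 4^3, 3^4) is a weakly stable triple.) -/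
noncomputable section

open Matrix MvPolynomial

/-- The coefficients of the binary cubic `det (s X + t Y)`. -/
def detPencilCoeff {R : Type*} [CommRing R] (X Y : Matrix (Fin 3) (Fin 3) R) : Fin 4 → R :=
  ![X.det, ∑ j, (X.updateCol j fun i => Y i j).det, ∑ j, (Y.updateCol j fun i => X i j).det, Y.det]

/-- The signed maximal minors of a `3 × 4` matrix. -/
def signedMinor {R : Type*} [CommRing R] (A : Matrix (Fin 3) (Fin 4) R) (k : Fin 4) : R :=
  (-1) ^ (k : ℕ) * (A.submatrix id k.succAbove).det

/-- The square matrix obtained by adding the row `w` on top of `A`. -/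
def consRow {R : Type*} (w : Fin 4 → R) (A : Matrix (Fin 3) (Fin 4) R) :
    Matrix (Fin 4) (Fin 4) R :=
  Matrix.of fun i k => Fin.cases (w k) (fun j => A j k) i

/-- The coefficients of the signed maximal minors of the pencil `s A + t B`. -/
def minorCoeff {R : Type*} [CommRing R] (A B : Matrix (Fin 3) (Fin 4) R) :
    Matrix (Fin 4) (Fin 4) R :=
  Matrix.of fun k n => (-1) ^ (k : ℕ) *
    detPencilCoeff (A.submatrix id k.succAbove) (B.submatrix id k.succAbove) n

section DetPencil

variable {R S : Type*} [CommRing R] [CommRing S]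

lemma map_detPencilCoeff (φ : R →+* S) (X Y : Matrix (Fin 3) (Fin 3) R) (n : Fin 4) :
    φ (detPencilCoeff X Y n) = detPencilCoeff (X.map φ) (Y.map φ) n := by
  fin_cases n <;>
    simp [detPencilCoeff, det_fin_three, Fin.sum_univ_three, updateCol_apply]

lemma map_minorCoeff (φ : R →+* S) (A B : Matrix (Fin 3) (Fin 4) R) :
    (minorCoeff A B).map φ = minorCoeff (A.map φ) (B.map φ) := by
  ext k n
  simp [minorCoeff, map_detPencilCoeff, submatrix_map]

lemma detPencilCoeff_linear_comb (X Y : Matrix (Fin 3) (Fin 3) R) (a b c d : R) (n : Fin 4) :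
    detPencilCoeff (a • X + b • Y) (c • X + d • Y) n = ∑ m, detPencilCoeff X Y m *
      !![a ^ 3, 3 * a ^ 2 * c, 3 * a * c ^ 2, c ^ 3;
        a ^ 2 * b, a ^ 2 * d + 2 * a * b * c, 2 * a * c * d + b * c ^ 2, c ^ 2 * d;
        a * b ^ 2, b ^ 2 * c + 2 * a * b * d, 2 * b * c * d + a * d ^ 2, c * d ^ 2;
        b ^ 3, 3 * b ^ 2 * d, 3 * b * d ^ 2, d ^ 3] m n := by
  fin_cases n <;>
    simp [detPencilCoeff, det_fin_three, Fin.sum_univ_succ, updateCol_apply] <;> ring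

lemma det_symCube (a b c d : R) :
    (!![a ^ 3, 3 * a ^ 2 * c, 3 * a * c ^ 2, c ^ 3;
        a ^ 2 * b, a ^ 2 * d + 2 * a * b * c, 2 * a * c * d + b * c ^ 2, c ^ 2 * d;
        a * b ^ 2, b ^ 2 * c + 2 * a * b * d, 2 * b * c * d + a * d ^ 2, c * d ^ 2;
        b ^ 3, 3 * b ^ 2 * d, 3 * b * d ^ 2, d ^ 3] : Matrix (Fin 4) (Fin 4) R).det =
      (a * d - b * c) ^ 6 := by
  rw [det_succ_row_zero]
  simp [Fin.sum_univ_succ, det_fin_three, Fin.succAbove]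
  ring

lemma det_minorCoeff_linear_comb (A B : Matrix (Fin 3) (Fin 4) R) (a b c d : R) :
    (minorCoeff (a • A + b • B) (c • A + d • B)).det =
      (a * d - b * c) ^ 6 * (minorCoeff A B).det := by
  rw [← det_symCube, mul_comm, ← det_mul]
  congr 1
  ext k n
  refine (congrArg ((-1) ^ (k : ℕ) * ·) (detPencilCoeff_linear_comb _ _ a b c d n)).trans ?_
  rw [Finset.mul_sum, Matrix.mul_apply]
  exact Finset.sum_congr rfl fun m _ => (mul_assoc _ _ _).symm

lemma detPencilCoeff_spec (X Y : Matrix (Fin 3) (Fin 3) R) (t : R) :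
    (X + t • Y).det = ∑ n, detPencilCoeff X Y n * t ^ (n : ℕ) := by
  simp [detPencilCoeff, det_fin_three, Fin.sum_univ_succ, updateCol_apply]
  ring

lemma signedMinor_pencil (A B : Matrix (Fin 3) (Fin 4) R) (t : R) (k : Fin 4) :
    signedMinor (A + t • B) k = ∑ n, minorCoeff A B k n * t ^ (n : ℕ) := by
  simp only [minorCoeff, of_apply, mul_assoc, ← Finset.mul_sum]
  rw [← detPencilCoeff_spec]
  rfl

lemma dotProduct_signedMinor (A : Matrix (Fin 3) (Fin 4) R) (w : Fin 4 → R) :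
    w ⬝ᵥ signedMinor A = (consRow w A).det := by
  rw [det_succ_row_zero]
  refine Finset.sum_congr rfl fun k _ => ?_
  have : (consRow w A).submatrix Fin.succ k.succAbove =
      A.submatrix id k.succAbove := by ext i j; simp [consRow]
  rw [this]
  simp [signedMinor, consRow]
  ring

lemma mulVec_signedMinor_self (A : Matrix (Fin 3) (Fin 4) R) : A *ᵥ signedMinor A = 0 := by
  ext j
  refine (dotProduct_signedMinor A (A j)).trans (det_zero_of_row_eq (Fin.succ_ne_zero j).symm ?_)
  ext k
  simp [consRow]

lemma signedMinor_mul_right (A : Matrix (Fin 3) (Fin 4) R) (Q : Matrix (Fin 4) (Fin 4) R) :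
    Q *ᵥ signedMinor (A * Q) = Q.det • signedMinor A := by
  ext k
  have h : consRow (Q k) (A * Q) =
      consRow (Pi.single k 1) A * Q := by
    ext i j
    refine Fin.cases ?_ (fun i => ?_) i
    · simp [consRow, Matrix.mul_apply, Pi.single_apply]
    · simp [consRow, Matrix.mul_apply]
  refine (dotProduct_signedMinor (A * Q) (Q k)).trans ?_
  rw [h, det_mul, ← dotProduct_signedMinor, single_dotProduct]
  simp [mul_comm]

lemma signedMinor_mul_left (A : Matrix (Fin 3) (Fin 4) R) (P : Matrix (Fin 3) (Fin 3) R)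
    (k : Fin 4) : signedMinor (P * A) k = P.det * signedMinor A k := by
  have : (P * A).submatrix id k.succAbove = P * A.submatrix id k.succAbove := by
    ext i j; simp [Matrix.mul_apply]
  simp only [signedMinor, this, det_mul]
  ring

end DetPencil

/-- A polynomial function of degree at most four that vanishes identically has zero
coefficients. -/
lemma coeff_eq_zero_of_quartic {c : Fin 5 → ℂ} (h : ∀ t : ℂ, ∑ n, c n * t ^ (n : ℕ) = 0) :
    c = 0 := by
  let p : Polynomial ℂ := ∑ n : Fin 5, Polynomial.C (c n) * Polynomial.X ^ (n : ℕ)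
  have hp : p = 0 := Polynomial.funext fun t => by
    simpa [p, Polynomial.eval_finsetSum] using h t
  ext n
  have := congrArg (fun q => Polynomial.coeff q n) hp
  simpa [p, Polynomial.finsetSum_coeff, Polynomial.coeff_X_pow, Fin.val_inj] using this

lemma coeff_eq_of_cubic {c e : Fin 4 → ℂ}
    (h : ∀ t : ℂ, ∑ n, c n * t ^ (n : ℕ) = ∑ n, e n * t ^ (n : ℕ)) : c = e := by
  have := coeff_eq_zero_of_quartic (c := Fin.snoc (α := fun _ => ℂ) (fun n => c n - e n) 0) fun t => by
    simp only [Fin.sum_univ_castSucc (n := 4), Fin.snoc_castSucc, Fin.snoc_last]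
    simp [sub_mul, h t]
  ext n
  have h2 := congrFun this n.castSucc
  simpa [sub_eq_zero] using h2

lemma minorCoeff_mul_right (A B : Matrix (Fin 3) (Fin 4) ℂ) (Q : Matrix (Fin 4) (Fin 4) ℂ) :
    Q * minorCoeff (A * Q) (B * Q) = Q.det • minorCoeff A B := by
  ext i n
  revert n
  rw [← funext_iff]
  refine coeff_eq_of_cubic fun t => ?_
  have h := congrFun (signedMinor_mul_right (A + t • B) Q) i
  rw [Matrix.add_mul, Matrix.smul_mul] at h
  simp only [mulVec, dotProduct, Pi.smul_apply, signedMinor_pencil, smul_eq_mul] at h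
  simp only [Matrix.mul_apply, Finset.sum_mul, Matrix.smul_apply, smul_eq_mul, mul_assoc]
  rw [← Finset.mul_sum, ← h, Finset.sum_comm]
  simp only [Finset.mul_sum]

lemma minorCoeff_mul_left (A B : Matrix (Fin 3) (Fin 4) ℂ) (P : Matrix (Fin 3) (Fin 3) ℂ) :
    minorCoeff (P * A) (P * B) = P.det • minorCoeff A B := by
  ext k n
  revert n
  rw [← funext_iff]
  refine coeff_eq_of_cubic fun t => ?_
  have h := signedMinor_mul_left (A + t • B) P k
  rw [Matrix.mul_add, Matrix.mul_smul] at h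
  simp only [signedMinor_pencil] at h
  simp only [h, Matrix.smul_apply, smul_eq_mul, mul_assoc, ← Finset.mul_sum]

lemma det_minorCoeff_mul_left (A B : Matrix (Fin 3) (Fin 4) ℂ) (P : Matrix (Fin 3) (Fin 3) ℂ) :
    (minorCoeff (P * A) (P * B)).det = P.det ^ 4 * (minorCoeff A B).det := by
  rw [minorCoeff_mul_left, det_smul, Fintype.card_fin]

lemma det_minorCoeff_mul_right (A B : Matrix (Fin 3) (Fin 4) ℂ) {Q : Matrix (Fin 4) (Fin 4) ℂ}
    (hQ : Q.det ≠ 0) :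
    (minorCoeff (A * Q) (B * Q)).det = Q.det ^ 3 * (minorCoeff A B).det := by
  have h := congrArg Matrix.det (minorCoeff_mul_right A B Q)
  rw [det_mul, det_smul, Fintype.card_fin] at h
  exact mul_left_cancel₀ hQ (by rw [h]; ring)

/-- The first matrix of the standard pencil. -/
def stdLeft : Matrix (Fin 3) (Fin 4) ℂ := !![0, 1, 0, 0; 0, 0, 1, 0; 0, 0, 0, 1]

/-- The second matrix of the standard pencil. -/
def stdRight : Matrix (Fin 3) (Fin 4) ℂ := !![-1, 0, 0, 0; 0, -1, 0, 0; 0, 0, -1, 0]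

lemma pencil_mul_minorCoeff (A B : Matrix (Fin 3) (Fin 4) ℂ) :
    A * minorCoeff A B = (A * minorCoeff A B).submatrix id Fin.succ * stdLeft ∧
      B * minorCoeff A B = (A * minorCoeff A B).submatrix id Fin.succ * stdRight := by
  set M := minorCoeff A B with hM
  have key : ∀ j, ![(A * M) j 0, (A * M) j 1 + (B * M) j 0, (A * M) j 2 + (B * M) j 1,
      (A * M) j 3 + (B * M) j 2, (B * M) j 3] = 0 := by
    intro j
    refine coeff_eq_zero_of_quartic fun t => ?_
    have h := congrFun (mulVec_signedMinor_self (A + t • B)) j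
    simp only [mulVec, dotProduct, signedMinor_pencil, ← hM] at h
    simp [Fin.sum_univ_succ, Matrix.mul_apply] at h ⊢
    linear_combination h
  constructor
  · ext j k
    have h := congrFun (key j) 0
    fin_cases k <;> simp [stdLeft, Matrix.mul_apply (M := submatrix _ _ _), Fin.sum_univ_succ]
    simpa using h
  · ext j k
    have h := congrFun (key j) k.succ
    fin_cases k <;> simp [stdRight, Matrix.mul_apply (M := submatrix _ _ _), Fin.sum_univ_succ]
    all_goals simp at h
    · linear_combination h
    · linear_combination h
    · linear_combination h
    · exact h

lemma minorCoeff_std : minorCoeff stdLeft stdRight = 1 := by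
  ext k n
  revert n
  rw [← funext_iff]
  refine coeff_eq_of_cubic fun t => ?_
  rw [← signedMinor_pencil]
  fin_cases k <;>
    simp [signedMinor, stdLeft, stdRight, det_fin_three, Fin.succAbove, Matrix.one_apply] <;> ring

/-- The tensor with slices `A` and `B` along the first factor. -/
def slicePoint (A B : Matrix (Fin 3) (Fin 4) ℂ) : Fin 2 × Fin 3 × Fin 4 → ℂ :=
  fun v => ![A, B] v.1 v.2.1 v.2.2

lemma exists_slicePoint (a : Fin 2 × Fin 3 × Fin 4 → ℂ) : ∃ A B, slicePoint A B = a := by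
  refine ⟨Matrix.of fun j k => a (0, j, k), Matrix.of fun j k => a (1, j, k), ?_⟩
  ext ⟨i, j, k⟩
  fin_cases i <;> simp [slicePoint]

lemma eval_act_s14 {n₁ n₂ n₃ : ℕ}
    (g : SpecialLinearGroup (Fin n₁) ℂ × SpecialLinearGroup (Fin n₂) ℂ ×
      SpecialLinearGroup (Fin n₃) ℂ)
    (f : MvPolynomial (Fin n₁ × Fin n₂ × Fin n₃) ℂ) (a : Fin n₁ × Fin n₂ × Fin n₃ → ℂ) :
    eval a (act n₁ n₂ n₃ g f) = eval (fun v => ∑ w : Fin n₁ × Fin n₂ × Fin n₃,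
      (g.1.val w.1 v.1 * g.2.1.val w.2.1 v.2.1 * g.2.2.val w.2.2 v.2.2) * a w) f := by
  have : ((aeval a).comp (act n₁ n₂ n₃ g) : _ →ₐ[ℂ] ℂ) = aeval (fun v =>
      ∑ w : Fin n₁ × Fin n₂ × Fin n₃,
        (g.1.val w.1 v.1 * g.2.1.val w.2.1 v.2.1 * g.2.2.val w.2.2 v.2.2) * a w) := by
    ext v
    simp [act]
  simpa [aeval_eq_eval] using congrArg (fun φ => φ f) this

lemma eval_slicePoint_act
    (g : SpecialLinearGroup (Fin 2) ℂ × SpecialLinearGroup (Fin 3) ℂ ×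
      SpecialLinearGroup (Fin 4) ℂ)
    (f : MvPolynomial (Fin 2 × Fin 3 × Fin 4) ℂ) (A B : Matrix (Fin 3) (Fin 4) ℂ) :
    eval (slicePoint A B) (act 2 3 4 g f) = eval (slicePoint
      (g.2.1.valᵀ * (g.1.val 0 0 • A + g.1.val 1 0 • B) * g.2.2.val)
      (g.2.1.valᵀ * (g.1.val 0 1 • A + g.1.val 1 1 • B) * g.2.2.val)) f := by
  rw [eval_act_s14]
  congr 2
  ext ⟨i, j, k⟩
  have key : ∀ i : Fin 2, (∑ w : Fin 2 × Fin 3 × Fin 4,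
      (g.1.val w.1 i * g.2.1.val w.2.1 j * g.2.2.val w.2.2 k) * slicePoint A B w) =
      (g.2.1.valᵀ * (g.1.val 0 i • A + g.1.val 1 i • B) * g.2.2.val) j k := by
    intro i
    simp only [Fintype.sum_prod_type, Fin.sum_univ_two, slicePoint, Matrix.mul_apply,
      Finset.sum_mul, ← Finset.sum_add_distrib]
    rw [Finset.sum_comm]
    refine Finset.sum_congr rfl fun k' _ => Finset.sum_congr rfl fun j' _ => ?_
    simp
    ring
  fin_cases i
  · exact key 0
  · exact key 1

lemma eval_smul_of_isHomogeneous_s14 {σ R : Type*} [CommSemiring R] {f : MvPolynomial σ R} {d : ℕ}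
    (hf : f.IsHomogeneous d) (c : R) (a : σ → R) :
    eval (fun v => c * a v) f = c ^ d * eval a f := by
  rw [eval_eq, eval_eq, Finset.mul_sum]
  refine Finset.sum_congr rfl fun m hm => ?_
  have hd : ∑ i ∈ m.support, m i = d := by
    simpa [Finsupp.weight_apply, Finsupp.sum] using hf (mem_support_iff.mp hm)
  simp_rw [mul_pow, Finset.prod_mul_distrib, Finset.prod_pow_eq_pow_sum, hd]
  ring

lemma isHomogeneous_det {σ R ι : Type*} [CommRing R] [Fintype ι] [DecidableEq ι]
    {M : Matrix ι ι (MvPolynomial σ R)} {d : ℕ} (hM : ∀ i j, (M i j).IsHomogeneous d) :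
    M.det.IsHomogeneous (Fintype.card ι * d) := by
  rw [det_apply]
  refine IsHomogeneous.sum _ _ _ fun τ _ => ?_
  have h : (∏ i, M (τ i) i).IsHomogeneous (Fintype.card ι * d) := by
    simpa using IsHomogeneous.prod Finset.univ (fun i => M (τ i) i) (fun _ => d) fun i _ => hM _ _
  exact (homogeneousSubmodule σ R _).toAddSubgroup.zsmul_mem h _

/-- The fundamental invariant: the determinant of the matrix of coefficients of the maximal minors
of the generic pencil of `3 × 4` matrices. -/
def fundamentalInvariant : MvPolynomial (Fin 2 × Fin 3 × Fin 4) ℂ :=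
  (minorCoeff (Matrix.of fun j k => X (0, j, k)) (Matrix.of fun j k => X (1, j, k))).det

lemma eval_fundamentalInvariant (A B : Matrix (Fin 3) (Fin 4) ℂ) :
    eval (slicePoint A B) fundamentalInvariant = (minorCoeff A B).det := by
  rw [fundamentalInvariant, RingHom.map_det, RingHom.mapMatrix_apply, map_minorCoeff]
  congr 2 <;> ext j k <;> simp [slicePoint]

lemma isHomogeneous_detPencilCoeff {σ R : Type*} [CommRing R]
    {M N : Matrix (Fin 3) (Fin 3) (MvPolynomial σ R)} (hM : ∀ i j, (M i j).IsHomogeneous 1)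
    (hN : ∀ i j, (N i j).IsHomogeneous 1) (n : Fin 4) :
    (detPencilCoeff M N n).IsHomogeneous 3 := by
  have aux : ∀ {M N : Matrix (Fin 3) (Fin 3) (MvPolynomial σ R)},
      (∀ i j, (M i j).IsHomogeneous 1) → (∀ i j, (N i j).IsHomogeneous 1) →
      (∑ j, (M.updateCol j fun i => N i j).det).IsHomogeneous 3 := fun hM hN =>
    IsHomogeneous.sum _ _ _ fun j _ => isHomogeneous_det (d := 1) fun i k => by
      rw [updateCol_apply]
      split_ifs
      exacts [hN _ _, hM _ _]
  fin_cases n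
  · exact isHomogeneous_det hM
  · exact aux hM hN
  · exact aux hN hM
  · exact isHomogeneous_det hN

lemma isHomogeneous_fundamentalInvariant : fundamentalInvariant.IsHomogeneous 12 := by
  refine isHomogeneous_det (d := 3) fun k n => ?_
  have h := isHomogeneous_detPencilCoeff
    (M := (Matrix.of fun j k => (X (0, j, k) : MvPolynomial (Fin 2 × Fin 3 × Fin 4) ℂ)).submatrix
      id k.succAbove)
    (N := (Matrix.of fun j k => (X (1, j, k) : MvPolynomial (Fin 2 × Fin 3 × Fin 4) ℂ)).submatrix
      id k.succAbove) (fun i j => isHomogeneous_X _ _) (fun i j => isHomogeneous_X _ _) n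
  rcases neg_one_pow_eq_or (MvPolynomial (Fin 2 × Fin 3 × Fin 4) ℂ) (k : ℕ) with hk | hk
  · simpa [minorCoeff, hk] using h
  · simpa [minorCoeff, hk] using h.neg

lemma mem_invSpace {n₁ n₂ n₃ d : ℕ} {f : MvPolynomial (Fin n₁ × Fin n₂ × Fin n₃) ℂ} :
    f ∈ invSpace n₁ n₂ n₃ d ↔ f.IsHomogeneous d ∧ ∀ g, act n₁ n₂ n₃ g f = f := by
  simp [invSpace, Submodule.mem_iInf, LinearMap.mem_eqLocus]

lemma act_fundamentalInvariant (g : SpecialLinearGroup (Fin 2) ℂ × SpecialLinearGroup (Fin 3) ℂ ×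
    SpecialLinearGroup (Fin 4) ℂ) :
    act 2 3 4 g fundamentalInvariant = fundamentalInvariant := by
  refine MvPolynomial.funext fun a => ?_
  obtain ⟨A, B, rfl⟩ := exists_slicePoint a
  have h1 : g.1.val 0 0 * g.1.val 1 1 - g.1.val 1 0 * g.1.val 0 1 = 1 := by
    have h := g.1.2
    rw [det_fin_two] at h
    linear_combination h
  rw [eval_slicePoint_act, eval_fundamentalInvariant, eval_fundamentalInvariant,
    det_minorCoeff_mul_right _ _ (by simp), det_minorCoeff_mul_left, det_minorCoeff_linear_comb,
    h1]
  simp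

lemma exists_specialLinear_smul {n : ℕ} [NeZero n] {P : Matrix (Fin n) (Fin n) ℂ}
    (hP : P.det ≠ 0) :
    ∃ (c : ℂ) (S : SpecialLinearGroup (Fin n) ℂ), c ≠ 0 ∧ P = c • S.val := by
  obtain ⟨c, hc⟩ := IsAlgClosed.exists_pow_nat_eq P.det (NeZero.pos n)
  have hc0 : c ≠ 0 := by
    rintro rfl
    exact hP (by rw [← hc, zero_pow (NeZero.ne n)])
  refine ⟨c, ⟨c⁻¹ • P, ?_⟩, hc0, ?_⟩
  · rw [det_smul, Fintype.card_fin, ← hc, inv_pow, inv_mul_cancel₀ (pow_ne_zero _ hc0)]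
  · simp [smul_smul, hc0]

lemma slicePoint_smul (c : ℂ) (A B : Matrix (Fin 3) (Fin 4) ℂ) :
    slicePoint (c • A) (c • B) = fun v => c * slicePoint A B v := by
  ext ⟨i, j, k⟩
  fin_cases i <;> simp [slicePoint]

lemma eval_mul_of_mem_invSpace {d : ℕ} {f : MvPolynomial (Fin 2 × Fin 3 × Fin 4) ℂ}
    (hf : f ∈ invSpace 2 3 4 d) (P : SpecialLinearGroup (Fin 3) ℂ)
    (Q : SpecialLinearGroup (Fin 4) ℂ) (A B : Matrix (Fin 3) (Fin 4) ℂ) :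
    eval (slicePoint (P.val * A * Q.val) (P.val * B * Q.val)) f = eval (slicePoint A B) f := by
  conv_rhs => rw [← (mem_invSpace.mp hf).2 (1, P.transpose, Q), eval_slicePoint_act]
  simp

lemma eval_smul_mul_of_mem_invSpace {d : ℕ} {f : MvPolynomial (Fin 2 × Fin 3 × Fin 4) ℂ}
    (hf : f ∈ invSpace 2 3 4 d) (P : SpecialLinearGroup (Fin 3) ℂ)
    (Q : SpecialLinearGroup (Fin 4) ℂ) (c : ℂ) (A B : Matrix (Fin 3) (Fin 4) ℂ) :
    eval (slicePoint (c • (P.val * A * Q.val)) (c • (P.val * B * Q.val))) f =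
      c ^ d * eval (slicePoint A B) f := by
  rw [slicePoint_smul, eval_smul_of_isHomogeneous_s14 (mem_invSpace.mp hf).1,
    eval_mul_of_mem_invSpace hf]

lemma eq_zero_of_eval_std_eq_zero {d : ℕ} {f : MvPolynomial (Fin 2 × Fin 3 × Fin 4) ℂ}
    (hf : f ∈ invSpace 2 3 4 d) (h0 : eval (slicePoint stdLeft stdRight) f = 0) : f = 0 := by
  have hD : fundamentalInvariant ≠ 0 := by
    intro h
    have := eval_fundamentalInvariant stdLeft stdRight
    simp [h, minorCoeff_std] at this
  refine (mul_eq_zero.mp (MvPolynomial.funext fun a => ?_ : fundamentalInvariant * f = 0)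
    ).resolve_left hD
  obtain ⟨A, B, rfl⟩ := exists_slicePoint a
  rw [map_mul, map_zero, eval_fundamentalInvariant, mul_eq_zero, or_iff_not_imp_left]
  intro hAB
  obtain ⟨hA, hB⟩ := pencil_mul_minorCoeff A B
  set Q := minorCoeff A B with hQ
  set P := (A * Q).submatrix id Fin.succ
  have hP : P.det ≠ 0 := by
    intro hP
    have h := det_minorCoeff_mul_right A B hAB
    rw [hA, hB, det_minorCoeff_mul_left, hP, ← hQ, ← pow_succ] at h
    exact pow_ne_zero _ hAB (h.symm.trans (by ring))
  obtain ⟨p, P', -, hP'⟩ := exists_specialLinear_smul hP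
  obtain ⟨q, Q', hq, hQ'⟩ := exists_specialLinear_smul hAB
  have key : ∀ C V : Matrix (Fin 3) (Fin 4) ℂ, C * Q = P * V →
      C = (q⁻¹ * p) • (P'.val * V * (Q'⁻¹).val) := by
    intro C V h
    rw [hP', hQ', Matrix.mul_smul, Matrix.smul_mul] at h
    have hQQ : Q'.val * (Q'⁻¹).val = 1 := congrArg Subtype.val (mul_inv_cancel Q')
    calc C = q⁻¹ • (q • (C * Q'.val)) * (Q'⁻¹).val := by
          rw [smul_smul, inv_mul_cancel₀ hq, one_smul, Matrix.mul_assoc, hQQ, Matrix.mul_one]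
      _ = _ := by rw [h, smul_smul, Matrix.smul_mul]
  rw [key A _ hA, key B _ hB, eval_smul_mul_of_mem_invSpace hf, h0, mul_zero]

lemma dvd_of_eval_ne_zero {d : ℕ} {f : MvPolynomial (Fin 2 × Fin 3 × Fin 4) ℂ}
    (hf : f ∈ invSpace 2 3 4 d) {A B : Matrix (Fin 3) (Fin 4) ℂ}
    (h : eval (slicePoint A B) f ≠ 0) : 12 ∣ d := by
  have hz := Complex.isPrimitiveRoot_exp 12 (by norm_num)
  set z := Complex.exp (2 * Real.pi * Complex.I / (12 : ℕ))
  have h12 : z ^ 12 = 1 := hz.pow_eq_one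
  let P : SpecialLinearGroup (Fin 3) ℂ := ⟨z ^ 4 • 1, by
    rw [det_smul, det_one, Fintype.card_fin, mul_one, ← pow_mul, h12]⟩
  let Q : SpecialLinearGroup (Fin 4) ℂ := ⟨z ^ 9 • 1, by
    rw [det_smul, det_one, Fintype.card_fin, mul_one, ← pow_mul, pow_mul z 12 3, h12, one_pow]⟩
  have hPQ : ∀ C : Matrix (Fin 3) (Fin 4) ℂ, P.val * C * Q.val = z • C := by
    intro C
    have : z ^ 9 * z ^ 4 = z := by linear_combination z * h12
    simp [P, Q, smul_smul, this]
  have key := eval_mul_of_mem_invSpace hf P Q A B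
  rw [hPQ, hPQ, slicePoint_smul, eval_smul_of_isHomogeneous_s14 (mem_invSpace.mp hf).1] at key
  exact (hz.pow_eq_one_iff_dvd d).mp (mul_right_cancel₀ h (key.trans (one_mul _).symm))

/-- for the action of `SL₂(ℂ) × SL₃(ℂ) × SL₄(ℂ)` on `ℂ[x_{ijk}]`, the space of invariant polynomials homogeneous of degree `d` has dimension `1` if `12 ∣ d` and `0` otherwise (Dynkin diagram `E₇`; `(6², 4³, 3⁴)` is weakly stable). -/
theorem stmt14 (d : ℕ) :
    Module.rank ℂ ↥(invSpace 2 3 4 d) = if 12 ∣ d then 1 else 0 := by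
  split_ifs with hd
  · obtain ⟨m, rfl⟩ := hd
    have hmem : fundamentalInvariant ^ m ∈ invSpace 2 3 4 (12 * m) :=
      mem_invSpace.mpr ⟨isHomogeneous_fundamentalInvariant.pow m, fun g => by
        rw [map_pow, act_fundamentalInvariant]⟩
    have heval : eval (slicePoint stdLeft stdRight) (fundamentalInvariant ^ m) = 1 := by
      rw [map_pow, eval_fundamentalInvariant, minorCoeff_std, det_one, one_pow]
    rw [Module.rank_eq_one_iff_finrank_eq_one]
    refine finrank_eq_one ⟨_, hmem⟩ (fun h => ?_) fun f => ?_
    · simp [show fundamentalInvariant ^ m = 0 from Subtype.ext_iff.mp h] at heval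
    · refine ⟨eval (slicePoint stdLeft stdRight) f.1, Subtype.ext (sub_eq_zero.mp
        (eq_zero_of_eval_std_eq_zero (d := 12 * m)
          (Submodule.sub_mem _ (Submodule.smul_mem _ _ hmem) f.2) ?_))⟩
      rw [map_sub, Submodule.coe_smul, smul_eval, heval, mul_one, sub_self]
  · rw [(Submodule.eq_bot_iff _).mpr fun f hf => eq_zero_of_eval_std_eq_zero hf
      (by_contra fun h => hd (dvd_of_eval_ne_zero hf h)), rank_bot]
end
end

section
/- Let R = ℂ[x_{ijk} : i ∈ {1,2}, j ∈ {1,2,3}, k ∈ {1,…,5}] and let G = SL_2(ℂ) × SL_3(ℂ) × SL_5(ℂ) act on R by ℂ-algebra automorphisms determined by the linear substitution (g_1,g_2,g_3)·x_{ijk} = Σ_{i',j',k'} (g_1)_{i'i}(g_2)_{j'j}(g_3)_{k'k} x_{i'j'k'}. Then for every natural number d ≥ 1, the only polynomial in R that is homogeneous of degree d and fixed by every element of G is 0; i.e. there is no nontrivial G-invariant. (This corresponds to the Dynkin diagram E_8: the action of GL_2 × GL_3 × GL_5 on ℂ^2 ⊗ ℂ^3 ⊗ ℂ^5 has a dense orbit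 whose complement has codimension greater than one.) -/
noncomputable section

open Matrix in
theorem det_smul_one_add_smul_mul {m n : Type*} [Fintype m] [DecidableEq m] [Fintype n]
    [DecidableEq n] {R : Type*} [CommRing R] (U : Matrix n m R) (Z : Matrix m n R)
    (hZU : Z * U = 1) (c t : R) :
    (c • (1 + t • (U * Z))).det = c ^ Fintype.card n * (1 + t) ^ Fintype.card m := by
  have h : (1 : Matrix m m R) + t • 1 = (1 + t) • 1 := by rw [add_smul, one_smul]
  rw [det_smul, ← smul_mul, det_one_add_mul_comm, Matrix.mul_smul, hZU, h, det_smul, det_one, mul_one]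

theorem MvPolynomial.IsHomogeneous.eval_smul_eq {σ R : Type*} [CommRing R] {P : MvPolynomial σ R}
    {d : ℕ} (hP : P.IsHomogeneous d) (c : R) (x : σ → R) :
    MvPolynomial.eval (c • x) P = c ^ d * MvPolynomial.eval x P := by
  rw [MvPolynomial.eval_eq, MvPolynomial.eval_eq, Finset.mul_sum]
  refine Finset.sum_congr rfl fun m hm => ?_
  have hd : ∑ i ∈ m.support, m i = d := by
    rw [← Finsupp.degree_apply, Finsupp.degree_eq_weight_one]
    exact hP (MvPolynomial.mem_support_iff.mp hm)
  simp only [Pi.smul_apply, smul_eq_mul, mul_pow, Finset.prod_mul_distrib,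
    Finset.prod_pow_eq_pow_sum, hd]
  ring

theorem exists_dotProduct_eq_one {n K : Type*} [Fintype n] [DecidableEq n] [Field K]
    {v : n → K} (hv : v ≠ 0) : ∃ w : n → K, w ⬝ᵥ v = 1 := by
  obtain ⟨i, hi⟩ := Function.ne_iff.mp hv
  exact ⟨Pi.single i (v i)⁻¹, by rw [single_dotProduct]; exact inv_mul_cancel₀ hi⟩

theorem eval_act_one {n₁ n₂ n₃ : ℕ} (g : Matrix.SpecialLinearGroup (Fin n₂) ℂ)
    (h : Matrix.SpecialLinearGroup (Fin n₃) ℂ) (A : Fin n₁ → Matrix (Fin n₂) (Fin n₃) ℂ)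
    (P : MvPolynomial (Fin n₁ × Fin n₂ × Fin n₃) ℂ) :
    MvPolynomial.eval (fun v => A v.1 v.2.1 v.2.2) (act n₁ n₂ n₃ (1, g, h) P) =
      MvPolynomial.eval (fun v => (g.val.transpose * A v.1 * h.val) v.2.1 v.2.2) P := by
  rw [act, MvPolynomial.aeval_def, MvPolynomial.algebraMap_eq, MvPolynomial.eval_eval₂,
    MvPolynomial.eval]
  congr 1
  · ext; simp
  · ext v
    simp only [map_sum, Fintype.sum_prod_type,
      Matrix.mul_apply, Matrix.transpose_apply, Finset.sum_mul]
    rw [Finset.sum_eq_single v.1]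
    · rw [Finset.sum_comm]
      refine Finset.sum_congr rfl fun k _ => Finset.sum_congr rfl fun j _ => ?_
      simp
      ring
    · intro i _ hi
      simp [Matrix.one_apply_ne hi]
    · simp

/-- A nonzero common kernel vector of the slices allows `SL₅` alone to halve all of them. -/
theorem exists_halving_of_common_kernel (A : Fin 2 → Matrix (Fin 3) (Fin 5) ℂ) {u : Fin 5 → ℂ}
    (hu : u ≠ 0) (hA : ∀ i, (A i).mulVec u = 0) :
    ∃ h : Matrix.SpecialLinearGroup (Fin 5) ℂ, ∀ i, A i * h.val = (1 / 2 : ℂ) • A i := by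
  obtain ⟨w, hw⟩ := exists_dotProduct_eq_one hu
  have hZU : Matrix.replicateRow Unit w * Matrix.replicateCol Unit u = 1 := by
    ext; simp [Matrix.mul_apply, ← hw, dotProduct]
  refine ⟨⟨(1 / 2 : ℂ) • (1 + (31 : ℂ) •
    (Matrix.replicateCol Unit u * Matrix.replicateRow Unit w)), ?_⟩, fun i => ?_⟩
  · rw [det_smul_one_add_smul_mul _ _ hZU]
    norm_num
  · have h0 : A i * Matrix.replicateCol Unit u = 0 := by
      rw [← Matrix.replicateCol_mulVec, hA]; rfl
    simp only [Matrix.mul_smul, Matrix.mul_add, Matrix.mul_one, ← Matrix.mul_assoc, h0,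
      Matrix.zero_mul, smul_zero, add_zero]

theorem exists_halving_of_mulVec_eq_ite (A : Fin 2 → Matrix (Fin 3) (Fin 5) ℂ)
    {u : Fin 2 → Fin 5 → ℂ} {v : Fin 3 → ℂ} (hv : v ≠ 0)
    (hA : ∀ i i', (A i).mulVec (u i') = if i = i' then v else 0) :
    ∃ (g : Matrix.SpecialLinearGroup (Fin 3) ℂ) (h : Matrix.SpecialLinearGroup (Fin 5) ℂ),
      ∀ i, g.val.transpose * A i * h.val = (1 / 2 : ℂ) • A i := by
  obtain ⟨w, hw⟩ := exists_dotProduct_eq_one hv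
  set V := Matrix.replicateCol Unit v
  set W := Matrix.replicateRow Unit w
  set U : Matrix (Fin 5) (Fin 2) ℂ := (Matrix.of u).transpose
  set Z : Matrix (Fin 2) (Fin 5) ℂ := Matrix.of fun i => Matrix.vecMul w (A i)
  have hWV : W * V = 1 := by
    ext; simp [V, W, Matrix.mul_apply, ← hw, dotProduct]
  have hZU : Z * U = 1 := by
    ext i i'
    change Matrix.vecMul w (A i) ⬝ᵥ u i' = _
    rw [← Matrix.dotProduct_mulVec, hA, Matrix.one_apply]
    split_ifs <;> simp [hw]
  have hAE (i) : A i * (U * Z) = V * W * A i := by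
    rw [← Matrix.mul_assoc, Matrix.mul_assoc V]
    ext j k
    have hU (i') : (A i * U) j i' = if i = i' then v j else 0 := by
      change (A i).mulVec (u i') j = _
      rw [hA]
      split_ifs <;> rfl
    rw [Matrix.mul_apply]
    simp only [hU, ite_mul, zero_mul, Finset.sum_ite_eq, Finset.mem_univ, if_true]
    simp [V, W, Z, Matrix.mul_apply, Matrix.vecMul, dotProduct]
  have hE : U * Z * (U * Z) = U * Z := by
    rw [Matrix.mul_assoc, ← Matrix.mul_assoc Z, hZU, Matrix.one_mul]
  refine ⟨⟨((32 : ℂ) • (1 + ((2 : ℂ)⁻¹ ^ 15 - 1) • (V * W))).transpose, ?_⟩,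
    ⟨(1 / 64 : ℂ) • (1 + ((2 : ℂ) ^ 15 - 1) • (U * Z)), ?_⟩, fun i => ?_⟩
  · rw [Matrix.det_transpose, det_smul_one_add_smul_mul _ _ hWV]
    norm_num
  · rw [det_smul_one_add_smul_mul _ _ hZU]
    norm_num
  · have hPAE : V * W * A i * (U * Z) = V * W * A i := by
      rw [← hAE, Matrix.mul_assoc, hE]
    simp only [Matrix.transpose_transpose, Matrix.smul_mul, Matrix.mul_smul, Matrix.add_mul,
      Matrix.mul_add, Matrix.one_mul, Matrix.mul_one, hPAE, hAE]
    module

theorem exists_mulVec_eq_ite (A : Fin 2 → Matrix (Fin 3) (Fin 5) ℂ) :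
    ∃ (u : Fin 2 → Fin 5 → ℂ) (v : Fin 3 → ℂ), (u ≠ 0 ∨ v ≠ 0) ∧
      ∀ i i', (A i).mulVec (u i') = if i = i' then v else 0 := by
  let φ : (Fin 2 → Fin 5 → ℂ) × (Fin 3 → ℂ) →ₗ[ℂ] (Fin 2 → Fin 2 → Fin 3 → ℂ) :=
    { toFun := fun p i i' => (A i).mulVec (p.1 i') - if i = i' then p.2 else 0
      map_add' := fun p q => by
        ext i i' j
        by_cases h : i = i' <;> simp [h, Matrix.mulVec_add] <;> ring
      map_smul' := fun c p => by
        ext i i' j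
        by_cases h : i = i' <;> simp [h, Matrix.mulVec_smul]
        ring }
  have hφ : LinearMap.ker φ ≠ ⊥ := LinearMap.ker_ne_bot_of_finrank_lt (by simp [Module.finrank_pi_fintype])
  obtain ⟨⟨u, v⟩, hp, hne⟩ := (Submodule.ne_bot_iff _).mp hφ
  refine ⟨u, v, ?_, fun i i' => sub_eq_zero.mp (congrFun (congrFun hp i) i')⟩
  rw [← not_and_or]
  exact fun h => hne (Prod.ext h.1 h.2)

theorem exists_halving (A : Fin 2 → Matrix (Fin 3) (Fin 5) ℂ) :
    ∃ (g : Matrix.SpecialLinearGroup (Fin 3) ℂ) (h : Matrix.SpecialLinearGroup (Fin 5) ℂ),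
      ∀ i, g.val.transpose * A i * h.val = (1 / 2 : ℂ) • A i := by
  obtain ⟨u, v, hne, hA⟩ := exists_mulVec_eq_ite A
  by_cases hv : v = 0
  · obtain ⟨i', hi'⟩ := Function.ne_iff.mp (hne.resolve_right (not_not.mpr hv))
    obtain ⟨h, hh⟩ := exists_halving_of_common_kernel A hi' fun i => by rw [hA, hv, ite_self]
    exact ⟨1, h, fun i => by simpa using hh i⟩
  · exact exists_halving_of_mulVec_eq_ite A hv hA

/-- for the action of `SL₂(ℂ) × SL₃(ℂ) × SL₅(ℂ)` on
`ℂ[x_{ijk} : i ∈ {1,2}, j ∈ {1,2,3}, k ∈ {1,…,5}]`, and every degree `d ≥ 1`,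
the only homogeneous polynomial of degree `d` fixed by every element of the group
is `0`: there is no nontrivial invariant (Dynkin diagram `E₈`). -/
theorem stmt15 (d : ℕ) (hd : 1 ≤ d) :
    ∀ P : MvPolynomial (Fin 2 × Fin 3 × Fin 5) ℂ, P.IsHomogeneous d →
      (∀ g : Matrix.SpecialLinearGroup (Fin 2) ℂ × Matrix.SpecialLinearGroup (Fin 3) ℂ ×
          Matrix.SpecialLinearGroup (Fin 5) ℂ, act 2 3 5 g P = P) →
      P = 0 := by
  intro P hP hinv
  refine MvPolynomial.funext fun x => ?_
  let A : Fin 2 → Matrix (Fin 3) (Fin 5) ℂ := fun i => Matrix.of fun j k => x (i, j, k)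
  obtain ⟨g, h, hgh⟩ := exists_halving A
  have key := eval_act_one g h A P
  rw [hinv] at key
  simp only [hgh] at key
  change MvPolynomial.eval x P = MvPolynomial.eval ((1 / 2 : ℂ) • x) P at key
  rw [MvPolynomial.IsHomogeneous.eval_smul_eq hP] at key
  have hpow : (1 / 2 : ℂ) ^ d ≠ 1 := fun h1 => by
    have := congrArg norm h1
    rw [norm_pow, norm_one] at this
    exact (pow_lt_one₀ (norm_nonneg _) (by norm_num) (by omega)).ne this
  rw [map_zero]
  by_contra h0
  exact hpow (mul_right_cancel₀ h0 (key.symm.trans (one_mul _).symm))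
end
end
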